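/- For any finite simple graph G with at least one vertex, the largest real root λ₁(G) of the univariate independence polynomial of G satisfies −1/ω(G) ≤ λ₁(G), where ω(G) is the clique number of G; that is, I(G)(x) has a real root in the interval [−1/ω(G), 0). -/

import Mathlib

open scoped Classical

/-- The univariate independence polynomial `I(G)(x) = Σ_{S independent} x^{|S|}`. -/
noncomputable def uIndepPoly {V : Type*} [Fintype V] (G : SimpleGraph V) : Polynomial ℝ :=
  ∑ S ∈ Finset.univ.filter (fun S : Finset V => ∀ a ∈ S, ∀ b ∈ S, ¬ G.Adj a b),
    Polynomial.X ^ S.card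

/-- `λ₁(G)`, the largest real root of the univariate independence polynomial of `G`. -/
noncomputable def lam1 {V : Type*} [Fintype V] (G : SimpleGraph V) : ℝ :=
  sSup {x : ℝ | (uIndepPoly G).IsRoot x}

/-- The independence polynomial of the subgraph induced on `S`, evaluated at `x`. -/
noncomputable def indepSum {V : Type*} (G : SimpleGraph V) (S : Finset V) (x : ℝ) : ℝ :=
  ∑ A ∈ S.powerset.filter (fun A : Finset V => ∀ a ∈ A, ∀ b ∈ A, ¬ G.Adj a b), x ^ A.card

lemma eval_uIndepPoly {V : Type*} [Fintype V] (G : SimpleGraph V) (x : ℝ) :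
    (uIndepPoly G).eval x = indepSum G Finset.univ x := by
  simp only [uIndepPoly, indepSum, Polynomial.eval_finsetSum, Polynomial.eval_pow,
    Polynomial.eval_X]
  exact Finset.sum_congr (by ext A; simp) fun _ _ => rfl

lemma continuous_indepSum {V : Type*} (G : SimpleGraph V) (S : Finset V) :
    Continuous (indepSum G S) := by
  unfold indepSum
  fun_prop

lemma indepSum_pos_of_nonneg {V : Type*} (G : SimpleGraph V) (S : Finset V) {x : ℝ}
    (hx : 0 ≤ x) : 0 < indepSum G S x := by
  refine Finset.sum_pos' (fun A _ => pow_nonneg hx _) ⟨∅, ?_, ?_⟩ <;> simp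

/-- Deletion of a vertex: `I(S ∪ {v}) = I(S) + x · I(S ∖ N(v))`. -/
lemma indepSum_insert {V : Type*} (G : SimpleGraph V) {S : Finset V} {v : V} (hv : v ∉ S)
    (x : ℝ) : indepSum G (insert v S) x =
      indepSum G S x + x * indepSum G (S.filter fun u => ¬ G.Adj v u) x := by
  have hdisj : Disjoint
      (S.powerset.filter fun A : Finset V => ∀ a ∈ A, ∀ b ∈ A, ¬ G.Adj a b)
      (((S.filter fun u => ¬ G.Adj v u).powerset.filter
        fun A : Finset V => ∀ a ∈ A, ∀ b ∈ A, ¬ G.Adj a b).image (insert v)) := by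
    rw [Finset.disjoint_left]
    intro A hA hA'
    obtain ⟨B, -, rfl⟩ := Finset.mem_image.1 hA'
    exact hv (Finset.mem_powerset.1 (Finset.mem_filter.1 hA).1 (Finset.mem_insert_self v B))
  have hnot : ∀ A ∈ (S.filter fun u => ¬ G.Adj v u).powerset.filter
      fun A : Finset V => ∀ a ∈ A, ∀ b ∈ A, ¬ G.Adj a b, v ∉ A := fun A hA hvA =>
    hv (Finset.mem_filter.1 (Finset.mem_powerset.1 (Finset.mem_filter.1 hA).1 hvA)).1
  have hsplit : (insert v S).powerset.filter
        (fun A : Finset V => ∀ a ∈ A, ∀ b ∈ A, ¬ G.Adj a b) =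
      (S.powerset.filter fun A : Finset V => ∀ a ∈ A, ∀ b ∈ A, ¬ G.Adj a b) ∪
      (((S.filter fun u => ¬ G.Adj v u).powerset.filter
        fun A : Finset V => ∀ a ∈ A, ∀ b ∈ A, ¬ G.Adj a b).image (insert v)) := by
    ext A
    simp only [Finset.mem_union, Finset.mem_filter, Finset.mem_powerset, Finset.mem_image]
    constructor
    · rintro ⟨hAS, hA⟩
      by_cases hvA : v ∈ A
      · refine Or.inr ⟨A.erase v, ⟨fun u hu => ?_, fun a ha b hb => ?_⟩,
          Finset.insert_erase hvA⟩
        · have hu' := Finset.mem_erase.1 hu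
          exact Finset.mem_filter.2
            ⟨Finset.mem_of_mem_insert_of_ne (hAS hu'.2) hu'.1, hA v hvA u hu'.2⟩
        · exact hA a (Finset.mem_of_mem_erase ha) b (Finset.mem_of_mem_erase hb)
      · exact Or.inl ⟨(Finset.subset_insert_iff_of_notMem hvA).1 hAS, hA⟩
    · rintro (⟨hAS, hA⟩ | ⟨B, ⟨hBS, hB⟩, rfl⟩)
      · exact ⟨hAS.trans (Finset.subset_insert v S), hA⟩
      · have hvB : ∀ u ∈ B, ¬ G.Adj v u := fun u hu => (Finset.mem_filter.1 (hBS hu)).2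
        refine ⟨Finset.insert_subset_insert v (hBS.trans (Finset.filter_subset _ S)), ?_⟩
        intro a ha b hb
        rcases Finset.mem_insert.1 ha with rfl | haB <;>
          rcases Finset.mem_insert.1 hb with rfl | hbB
        · exact G.irrefl
        · exact hvB b hbB
        · exact fun h => hvB a haB h.symm
        · exact hB a haB b hbB
  unfold indepSum
  rw [hsplit, Finset.sum_union hdisj, Finset.sum_image, Finset.mul_sum]
  · congr 1
    refine Finset.sum_congr rfl fun A hA => ?_
    rw [Finset.card_insert_of_notMem (hnot A hA), pow_succ']
  · intro A hA B hB h
    rw [← Finset.erase_insert (hnot A hA), ← Finset.erase_insert (hnot B hB), h]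

/-- Monotonicity of the largest root: if the independence polynomial of an induced subgraph is
nonpositive at `x < 0`, then that of the larger graph is nonpositive somewhere in `[x, 0)`. -/
lemma exists_indepSum_nonpos_of_subset {V : Type*} (G : SimpleGraph V) (S : Finset V) :
    ∀ T ⊆ S, ∀ x < 0, indepSum G T x ≤ 0 → ∃ y, x ≤ y ∧ y < 0 ∧ indepSum G S y ≤ 0 := by
  induction S using Finset.strongInduction with
  | H S ih =>
    intro T hTS x hx hTx
    by_cases hST : S ⊆ T
    · exact ⟨x, le_rfl, hx, hTS.antisymm hST ▸ hTx⟩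
    obtain ⟨v, hvS, hvT⟩ := Finset.not_subset.1 hST
    have ih' := ih _ (Finset.erase_ssubset hvS)
    obtain ⟨y, hxy, hy, hSy⟩ := ih' T (Finset.subset_erase.2 ⟨hTS, hvT⟩) x hx hTx
    have hcomp : IsCompact (Set.Icc y 0 ∩ {t | indepSum G (S.erase v) t ≤ 0}) :=
      isCompact_Icc.inter_right (isClosed_le (continuous_indepSum G _) continuous_const)
    obtain ⟨z, ⟨⟨hyz, hz0⟩, hz⟩, hmax⟩ :=
      hcomp.exists_isGreatest ⟨y, ⟨le_rfl, hy.le⟩, hSy⟩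
    have hzneg : z < 0 := hz0.lt_of_ne fun h =>
      (indepSum_pos_of_nonneg G (S.erase v) h.ge).not_ge hz
    refine ⟨z, hxy.trans hyz, hzneg, ?_⟩
    have hnbr : 0 ≤ indepSum G ((S.erase v).filter fun u => ¬ G.Adj v u) z := by
      by_contra! hneg
      have hev := ((continuous_indepSum G _).continuousAt.eventually_lt_const hneg).filter_mono
        (nhdsWithin_le_nhds (s := Set.Ioi z))
      obtain ⟨w, hw, hzw, hw0⟩ := (hev.and (Ioo_mem_nhdsGT hzneg)).exists
      obtain ⟨t, hwt, ht0, ht⟩ := ih' _ (Finset.filter_subset _ _) w hw0 hw.le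
      have hzt : z < t := hzw.trans_le hwt
      exact (hmax ⟨⟨(hyz.trans_lt hzt).le, ht0.le⟩, ht⟩).not_gt hzt
    rw [← Finset.insert_erase hvS, indepSum_insert G (Finset.notMem_erase v S)]
    have hz' : indepSum G (S.erase v) z ≤ 0 := hz
    linarith [mul_nonpos_of_nonpos_of_nonneg hzneg.le hnbr]

lemma indepSum_of_isClique {V : Type*} (G : SimpleGraph V) {K : Finset V}
    (hK : G.IsClique K) (x : ℝ) : indepSum G K x = 1 + K.card * x := by
  induction K using Finset.induction_on with
  | empty => simp [indepSum, Finset.filter_singleton]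
  | insert v K hv ih =>
    have hempty : (K.filter fun u => ¬ G.Adj v u) = ∅ := by
      refine Finset.filter_eq_empty_iff.2 fun u hu => not_not.2 ?_
      exact hK (by simp) (by simp [hu]) (fun h => hv (h ▸ hu))
    rw [indepSum_insert G hv, hempty, ih (hK.subset (by simp)), Finset.card_insert_of_notMem hv]
    simp [indepSum, Finset.filter_singleton]
    ring

/-- For a finite simple graph `G` with at least one vertex, the largest real root of the
univariate independence polynomial satisfies `−1/ω(G) ≤ λ₁(G)`; that is, `I(G)(x)` has a
real root in the interval `[−1/ω(G), 0)`. -/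
theorem neg_inv_cliqueNum_le_lam1 {V : Type*} [Fintype V] [Nonempty V] (G : SimpleGraph V) :
    -1 / (G.cliqueNum : ℝ) ≤ lam1 G ∧
    ∃ x : ℝ, (uIndepPoly G).IsRoot x ∧ -1 / (G.cliqueNum : ℝ) ≤ x ∧ x < 0 := by
  have hroot : ∃ x : ℝ, (uIndepPoly G).IsRoot x ∧ -1 / (G.cliqueNum : ℝ) ≤ x ∧ x < 0 := by
    obtain ⟨K, hK⟩ := G.exists_isNClique_cliqueNum
    have hpos : 0 < (G.cliqueNum : ℝ) := by
      obtain ⟨v⟩ := ‹Nonempty V›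
      have hv : G.IsClique (({v} : Finset V) : Set V) := by simp
      have := hv.card_le_cliqueNum
      exact_mod_cast (by simpa using this : 1 ≤ G.cliqueNum)
    have hzero : indepSum G K (-1 / G.cliqueNum) = 0 := by
      rw [indepSum_of_isClique G hK.isClique, hK.card_eq]
      field_simp
      norm_num
    obtain ⟨y, hy, hy0, hyS⟩ := exists_indepSum_nonpos_of_subset G Finset.univ K
      (Finset.subset_univ K) _ (div_neg_of_neg_of_pos (by norm_num) hpos) hzero.le
    have h0 := indepSum_pos_of_nonneg G Finset.univ le_rfl
    obtain ⟨x, ⟨hyx, hx0⟩, hx⟩ := intermediate_value_Icc hy0.le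
      (continuous_indepSum G Finset.univ).continuousOn ⟨hyS, h0.le⟩
    refine ⟨x, (eval_uIndepPoly G x).trans hx, hy.trans hyx, hx0.lt_of_ne ?_⟩
    rintro rfl
    exact h0.ne' hx
  refine ⟨?_, hroot⟩
  obtain ⟨x, hx, hle, -⟩ := hroot
  refine hle.trans (le_csSup ⟨0, fun t ht => ?_⟩ hx)
  by_contra! hpos
  exact (indepSum_pos_of_nonneg G Finset.univ hpos.le).ne' ((eval_uIndepPoly G t).symm.trans ht)
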